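/- Let l, m ≥ 1, n = l+m+2, and H̃ bounded on [0,Y]. Then for suitable constants M > 0 and Y > 0 (with MY < √(l/m)), there exists a unique continuous r on (0,Y] with sup_{y∈(0,Y]}|r(y)/y| ≤ M satisfying r(y) = y^{-(l+m)} ∫₀^y [ -r(η)²(m r(η) + 2√(lm)) - √(lm){1 + (r(η)+√(l/m))²}· ( (√m/η)∫₀^η r(ξ)dξ ) / ( (√m/η)∫₀^η r(ξ)dξ + √l ) + (n-1)H̃(η){1 + (r(η)+√(l/m))²}^{3/2} η ] η^{l+m-1} dη. -/

import Mathlib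

open MeasureTheory Set Filter Topology

/-- The weighted mean `y⁻ᵏ ∫₀^y f(η) ηᵏ⁻¹ dη`. -/
noncomputable def weightedMean (k : ℕ) (f : ℝ → ℝ) (y : ℝ) : ℝ :=
  y ^ (-(k : ℤ)) * ∫ η in (0:ℝ)..y, f η * η ^ (k - 1)

/-- The functions on `(0, Y]` that are continuous and bounded by `M * y`. -/
def LinearlyBounded (Y M : ℝ) (r : ℝ → ℝ) : Prop :=
  ContinuousOn r (Ioc 0 Y) ∧ ∀ y ∈ Ioc (0:ℝ) Y, |r y| ≤ M * y

section WeightedMean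

variable {k : ℕ} {Y M c : ℝ} {f g r : ℝ → ℝ}

lemma weightedMean_sub {y : ℝ}
    (hf : IntervalIntegrable (fun η => f η * η ^ (k - 1)) volume 0 y)
    (hg : IntervalIntegrable (fun η => g η * η ^ (k - 1)) volume 0 y) :
    weightedMean k f y - weightedMean k g y = weightedMean k (fun η => f η - g η) y := by
  simp only [weightedMean, sub_mul]
  rw [intervalIntegral.integral_sub hf hg]
  ring

lemma weightedMean_one (f : ℝ → ℝ) (y : ℝ) : weightedMean 1 f y = (∫ η in (0:ℝ)..y, f η) / y := by
  simp [weightedMean, div_eq_inv_mul]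

lemma abs_weightedMean_le (hk : 1 ≤ k) (hb : ∀ y ∈ Ioc (0:ℝ) Y, |f y| ≤ c * y)
    {y : ℝ} (hy : y ∈ Ioc (0:ℝ) Y) : |weightedMean k f y| ≤ c / (k + 1) * y := by
  have hy0 := hy.1
  have hint : ‖∫ η in (0:ℝ)..y, f η * η ^ (k - 1)‖ ≤ ∫ η in (0:ℝ)..y, c * η ^ k := by
    refine intervalIntegral.norm_integral_le_of_norm_le hy0.le
      (Eventually.of_forall fun η hη => ?_)
      ((by fun_prop : Continuous fun η : ℝ => c * η ^ k).intervalIntegrable _ _)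
    have h := mul_le_mul_of_nonneg_right (hb η ⟨hη.1, hη.2.trans hy.2⟩)
      (pow_nonneg hη.1.le (k - 1))
    rw [Real.norm_eq_abs, abs_mul, abs_of_nonneg (pow_nonneg hη.1.le (k - 1))]
    rwa [mul_assoc, mul_pow_sub_one (by omega)] at h
  rw [intervalIntegral.integral_const_mul, integral_pow, Real.norm_eq_abs] at hint
  rw [weightedMean, abs_mul, abs_of_nonneg (by positivity), zpow_neg, zpow_natCast]
  refine (mul_le_mul_of_nonneg_left hint (by positivity)).trans_eq ?_
  have : (k:ℝ) + 1 ≠ 0 := by positivity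
  field_simp
  simp only [ne_eq, Nat.add_eq_zero_iff, one_ne_zero, and_false, not_false_eq_true, zero_pow,
    sub_zero]
  ring

lemma integrableOn_mul_pow (hf : AEMeasurable f (volume.restrict (Ioc 0 Y)))
    (hb : ∀ y ∈ Ioc (0:ℝ) Y, |f y| ≤ c * y) (j : ℕ) :
    IntegrableOn (fun η => f η * η ^ j) (Ioc 0 Y) := by
  refine Integrable.mono' (g := fun η => c * η * η ^ j) ?_ ?_ ?_
  · exact ((by fun_prop : Continuous fun η : ℝ => c * η * η ^ j).integrableOn_Icc).mono_set
      Ioc_subset_Icc_self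
  · exact (hf.mul (by fun_prop)).aestronglyMeasurable
  · refine (ae_restrict_iff' measurableSet_Ioc).2 (Eventually.of_forall fun η hη => ?_)
    rw [Real.norm_eq_abs, abs_mul, abs_of_nonneg (pow_nonneg hη.1.le j)]
    exact mul_le_mul_of_nonneg_right (hb η hη) (pow_nonneg hη.1.le j)

lemma intervalIntegrable_mul_pow (hf : AEMeasurable f (volume.restrict (Ioc 0 Y)))
    (hb : ∀ y ∈ Ioc (0:ℝ) Y, |f y| ≤ c * y) (j : ℕ) {y : ℝ} (hy : y ∈ Ioc 0 Y) :
    IntervalIntegrable (fun η => f η * η ^ j) volume 0 y := by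
  rw [intervalIntegrable_iff_integrableOn_Ioc_of_le hy.1.le]
  exact (integrableOn_mul_pow hf hb j).mono_set (Ioc_subset_Ioc_right hy.2)

lemma linearlyBounded_weightedMean (hk : 1 ≤ k) (hf : AEMeasurable f (volume.restrict (Ioc 0 Y)))
    (hb : ∀ y ∈ Ioc (0:ℝ) Y, |f y| ≤ c * y) :
    LinearlyBounded Y (c / (k + 1)) (weightedMean k f) := by
  refine ⟨?_, fun y hy => abs_weightedMean_le hk hb hy⟩
  rcases le_or_gt Y 0 with hY | hY
  · simp [Ioc_eq_empty_of_le hY]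
  refine ContinuousOn.mul (fun y hy => (continuousAt_zpow₀ y _ (Or.inl hy.1.ne')).continuousWithinAt)
    ((intervalIntegral.continuousOn_primitive_interval (b := Y) ?_).mono ?_)
  · rw [uIcc_of_le hY.le, integrableOn_Icc_iff_integrableOn_Ioc]
    exact integrableOn_mul_pow hf hb _
  · rw [uIcc_of_le hY.le]
    exact Ioc_subset_Icc_self

namespace LinearlyBounded

lemma aemeasurable (hr : LinearlyBounded Y M r) : AEMeasurable r (volume.restrict (Ioc 0 Y)) :=
  hr.1.aemeasurable measurableSet_Ioc

lemma mono {Z : ℝ} (hr : LinearlyBounded Y M r) (hZ : Z ≤ Y) : LinearlyBounded Z M r :=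
  ⟨hr.1.mono (Ioc_subset_Ioc_right hZ), fun y hy => hr.2 y ⟨hy.1, hy.2.trans hZ⟩⟩

lemma mono_bound {N : ℝ} (hr : LinearlyBounded Y M r) (hM : M ≤ N) : LinearlyBounded Y N r :=
  ⟨hr.1, fun y hy => (hr.2 y hy).trans (mul_le_mul_of_nonneg_right hM hy.1.le)⟩

lemma sub {s : ℝ → ℝ} {N : ℝ} (hr : LinearlyBounded Y M r) (hs : LinearlyBounded Y N s) :
    LinearlyBounded Y (M + N) (fun y => r y - s y) :=
  ⟨hr.1.sub hs.1, fun y hy => (abs_sub _ _).trans (by linarith [hr.2 y hy, hs.2 y hy])⟩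

lemma mean (hr : LinearlyBounded Y M r) : LinearlyBounded Y (M / 2) (weightedMean 1 r) := by
  have := linearlyBounded_weightedMean le_rfl hr.aemeasurable hr.2
  norm_num at this
  exact this

lemma iff_abs_div_le :
    LinearlyBounded Y M r ↔ ContinuousOn r (Ioc 0 Y) ∧ ∀ y ∈ Ioc (0:ℝ) Y, |r y / y| ≤ M := by
  refine and_congr_right fun _ => forall₂_congr fun y hy => ?_
  rw [abs_div, abs_of_pos hy.1, div_le_iff₀ hy.1]

end LinearlyBounded

end WeightedMean

section Picard

/-- The integral operator whose fixed points are the solutions of the integral equation. -/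
noncomputable def picard (k : ℕ) (Φ : ℝ → ℝ → ℝ → ℝ) (r : ℝ → ℝ) : ℝ → ℝ :=
  weightedMean k fun η => Φ η (r η) (weightedMean 1 r η)

/-- The measurability and Lipschitz conditions on a source term which make `picard` a contraction
on `LinearlyBounded Y M`. -/
structure IsLipschitzSource (Y M c L : ℝ) (Φ : ℝ → ℝ → ℝ → ℝ) : Prop where
  aemeasurable : ∀ r w : ℝ → ℝ, AEMeasurable r (volume.restrict (Ioc 0 Y)) →
    AEMeasurable w (volume.restrict (Ioc 0 Y)) →
    AEMeasurable (fun η => Φ η (r η) (w η)) (volume.restrict (Ioc 0 Y))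
  zero : ∀ η ∈ Ioc (0:ℝ) Y, |Φ η 0 0| ≤ c * η
  lipschitz : ∀ η ∈ Ioc (0:ℝ) Y, ∀ d ρ₁ ρ₂ w₁ w₂ : ℝ,
    |ρ₁| ≤ M * η → |ρ₂| ≤ M * η → |w₁| ≤ M / 2 * η → |w₂| ≤ M / 2 * η →
    |ρ₁ - ρ₂| ≤ d * η → |w₁ - w₂| ≤ d / 2 * η → |Φ η ρ₁ w₁ - Φ η ρ₂ w₂| ≤ L * d * η

namespace IsLipschitzSource

variable {k : ℕ} {Y M c L d : ℝ} {Φ : ℝ → ℝ → ℝ → ℝ} {r s : ℝ → ℝ}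

lemma aemeasurable_comp (hΦ : IsLipschitzSource Y M c L Φ) (hr : LinearlyBounded Y M r) :
    AEMeasurable (fun η => Φ η (r η) (weightedMean 1 r η)) (volume.restrict (Ioc 0 Y)) :=
  hΦ.aemeasurable _ _ hr.aemeasurable hr.mean.aemeasurable

lemma abs_comp_le (hΦ : IsLipschitzSource Y M c L Φ) (hM : 0 ≤ M) (hr : LinearlyBounded Y M r) :
    ∀ η ∈ Ioc (0:ℝ) Y, |Φ η (r η) (weightedMean 1 r η)| ≤ (c + L * M) * η := by
  intro η hη
  have hη0 := hη.1
  have h0 : |(0:ℝ)| ≤ M * η := by simpa using by positivity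
  have h0' : |(0:ℝ)| ≤ M / 2 * η := by simpa using by positivity
  have h := hΦ.lipschitz η hη M (r η) 0 (weightedMean 1 r η) 0 (hr.2 η hη) h0 (hr.mean.2 η hη) h0'
    (by simpa using hr.2 η hη) (by simpa using hr.mean.2 η hη)
  have h1 := hΦ.zero η hη
  have h2 := abs_add_le (Φ η (r η) (weightedMean 1 r η) - Φ η 0 0) (Φ η 0 0)
  rw [sub_add_cancel] at h2
  linarith

lemma picard_linearlyBounded (hΦ : IsLipschitzSource Y M c L Φ) (hk : 1 ≤ k) (hM : 0 ≤ M)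
    (hc : c + L * M ≤ (k + 1) * M) (hr : LinearlyBounded Y M r) :
    LinearlyBounded Y M (picard k Φ r) := by
  refine (linearlyBounded_weightedMean hk (hΦ.aemeasurable_comp hr)
    (hΦ.abs_comp_le hM hr)).mono_bound ?_
  rw [div_le_iff₀ (by positivity)]
  linarith

lemma abs_picard_sub_le (hΦ : IsLipschitzSource Y M c L Φ) (hk : 1 ≤ k) (hM : 0 ≤ M)
    (hr : LinearlyBounded Y M r) (hs : LinearlyBounded Y M s)
    (hd : ∀ y ∈ Ioc (0:ℝ) Y, |r y - s y| ≤ d * y) :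
    ∀ y ∈ Ioc (0:ℝ) Y, |picard k Φ r y - picard k Φ s y| ≤ L / (k + 1) * d * y := by
  intro y hy
  have hmean : ∀ η ∈ Ioc (0:ℝ) Y, |weightedMean 1 r η - weightedMean 1 s η| ≤ d / 2 * η := by
    intro η hη
    rw [weightedMean_sub (intervalIntegrable_mul_pow hr.aemeasurable hr.2 _ hη)
      (intervalIntegrable_mul_pow hs.aemeasurable hs.2 _ hη)]
    have := LinearlyBounded.mean (M := d) (r := fun η => r η - s η) ⟨hr.1.sub hs.1, hd⟩
    exact this.2 η hη
  rw [picard, picard,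
    weightedMean_sub
      (intervalIntegrable_mul_pow (hΦ.aemeasurable_comp hr) (hΦ.abs_comp_le hM hr) _ hy)
      (intervalIntegrable_mul_pow (hΦ.aemeasurable_comp hs) (hΦ.abs_comp_le hM hs) _ hy)]
  refine (abs_weightedMean_le hk (c := L * d) (fun η hη => ?_) hy).trans_eq (by ring)
  exact hΦ.lipschitz η hη d _ _ _ _ (hr.2 η hη) (hs.2 η hη) (hr.mean.2 η hη) (hs.mean.2 η hη)
    (hd η hη) (hmean η hη)

lemma eqOn_of_fixed (hΦ : IsLipschitzSource Y M c L Φ) (hk : 1 ≤ k) (hM : 0 ≤ M) (hL : 0 ≤ L)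
    (hLk : L < k + 1) (hr : LinearlyBounded Y M r) (hs : LinearlyBounded Y M s)
    (hr' : EqOn r (picard k Φ r) (Ioc 0 Y)) (hs' : EqOn s (picard k Φ s) (Ioc 0 Y)) :
    EqOn r s (Ioc 0 Y) := by
  have hq1 : L / (k + 1) < 1 := (div_lt_one (by positivity)).2 hLk
  have key : ∀ n : ℕ, ∀ y ∈ Ioc (0:ℝ) Y, |r y - s y| ≤ (L / (k + 1)) ^ n * (M + M) * y := by
    intro n
    induction n with
    | zero => simpa using (hr.sub hs).2
    | succ n ih =>
      intro y hy
      rw [hr' hy, hs' hy]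
      exact (hΦ.abs_picard_sub_le hk hM hr hs ih y hy).trans_eq (by ring)
  intro y hy
  have hlim : Tendsto (fun n : ℕ => (L / (k + 1)) ^ n * (M + M) * y) atTop (𝓝 0) := by
    simpa using ((tendsto_pow_atTop_nhds_zero_of_lt_one (by positivity) hq1).mul_const
      (M + M)).mul_const y
  have := ge_of_tendsto' hlim fun n => key n y hy
  exact sub_eq_zero.1 (abs_nonpos_iff.1 this)

lemma exists_fixed (hΦ : IsLipschitzSource Y M c L Φ) (hk : 1 ≤ k) (hM : 0 ≤ M) (hL : 0 ≤ L)
    (hLk : L < k + 1) (hc : c + L * M ≤ (k + 1) * M) :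
    ∃ r, LinearlyBounded Y M r ∧ EqOn r (picard k Φ r) (Ioc 0 Y) := by
  let S : Set (BoundedContinuousFunction (Ioc (0:ℝ) Y) ℝ) := Metric.closedBall 0 M
  let ext (u : BoundedContinuousFunction (Ioc (0:ℝ) Y) ℝ) (y : ℝ) : ℝ :=
    if h : y ∈ Ioc 0 Y then y * u ⟨y, h⟩ else 0
  have ext_apply : ∀ u y (hy : y ∈ Ioc 0 Y), ext u y = y * u ⟨y, hy⟩ := fun u y hy => dif_pos hy
  have hext : ∀ u ∈ S, LinearlyBounded Y M (ext u) := by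
    intro u hu
    refine ⟨?_, fun y hy => ?_⟩
    · rw [continuousOn_iff_continuous_domRestrict]
      have : (Ioc 0 Y).domRestrict (ext u) = fun y : Ioc (0:ℝ) Y => (y:ℝ) * u y := by
        funext y
        exact ext_apply u y y.2
      rw [this]
      exact continuous_subtype_val.mul u.continuous
    · rw [ext_apply u y hy, abs_mul, abs_of_pos hy.1, mul_comm]
      exact mul_le_mul_of_nonneg_right
        ((u.norm_coe_le_norm _).trans (mem_closedBall_zero_iff.1 hu)) hy.1.le
  have hstep : ∀ u : S, ∃ v : S, ∀ y : Ioc (0:ℝ) Y, v.1 y = picard k Φ (ext u) y / y := by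
    intro u
    have h := hΦ.picard_linearlyBounded hk hM hc (hext u u.2)
    have hb := (LinearlyBounded.iff_abs_div_le.1 h).2
    refine ⟨⟨BoundedContinuousFunction.ofNormedAddCommGroup
      (fun y : Ioc (0:ℝ) Y => picard k Φ (ext u) y / y) ?_ M (fun y => hb y y.2), ?_⟩,
      fun y => rfl⟩
    · exact (continuousOn_iff_continuous_domRestrict.1 h.1).div continuous_subtype_val
        fun y => y.2.1.ne'
    · exact mem_closedBall_zero_iff.2
        (BoundedContinuousFunction.norm_ofNormedAddCommGroup_le _ hM _)
  choose T hT using hstep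
  have hq1 : L / (k + 1) < 1 := (div_lt_one (by positivity)).2 hLk
  have hq0 : 0 ≤ L / ((k:ℝ) + 1) := by positivity
  have hcontr : ContractingWith ⟨L / (k + 1), hq0⟩ T := by
    refine ⟨by exact_mod_cast hq1, LipschitzWith.of_dist_le_mul fun u v => ?_⟩
    refine (BoundedContinuousFunction.dist_le (by positivity)).2 fun y => ?_
    have hd : ∀ y ∈ Ioc (0:ℝ) Y, |ext u y - ext v y| ≤ dist u v * y := by
      intro y hy
      rw [ext_apply _ y hy, ext_apply _ y hy, ← mul_sub, abs_mul, abs_of_pos hy.1, mul_comm]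
      exact mul_le_mul_of_nonneg_right
        (BoundedContinuousFunction.dist_coe_le_dist (f := u.1) (g := v.1) ⟨y, hy⟩) hy.1.le
    rw [hT, hT, Real.dist_eq, ← sub_div, abs_div, abs_of_pos y.2.1, div_le_iff₀ y.2.1]
    exact hΦ.abs_picard_sub_le hk hM (hext u u.2) (hext v v.2) hd y y.2
  have : CompleteSpace S := Metric.isClosed_closedBall.completeSpace_coe
  have : Nonempty S := ⟨⟨0, Metric.mem_closedBall_self hM⟩⟩
  let u := ContractingWith.fixedPoint T hcontr
  refine ⟨ext u, hext u u.2, fun y hy => ?_⟩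
  have hu : T u = u := hcontr.fixedPoint_isFixedPt
  have h := hT u ⟨y, hy⟩
  rw [hu] at h
  rw [ext_apply _ y hy, h]
  exact mul_div_cancel₀ _ hy.1.ne'

end IsLipschitzSource

end Picard

section SlopeSource

/-- The part of the integrand of the slope equation that does not involve the mean curvature, as a
function of the value `ρ` of `r` at a point and of the mean `w` of `r` up to that point. -/
noncomputable def steadySource (l m : ℕ) (ρ w : ℝ) : ℝ :=
  -(ρ ^ 2) * ((m:ℝ) * ρ + 2 * Real.sqrt ((l:ℝ) * (m:ℝ)))
    - Real.sqrt ((l:ℝ) * (m:ℝ)) * (1 + (ρ + Real.sqrt ((l:ℝ) / (m:ℝ))) ^ 2)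
      * ((Real.sqrt (m:ℝ) * w) / (Real.sqrt (m:ℝ) * w + Real.sqrt (l:ℝ)))

/-- The cube `(1 + q²)^(3/2)` of the length element of a curve of slope `q = ρ + √(l/m)`. -/
noncomputable def lengthCube (l m : ℕ) (ρ : ℝ) : ℝ :=
  (1 + (ρ + Real.sqrt ((l:ℝ) / (m:ℝ))) ^ 2) ^ ((3:ℝ)/2)

/-- The integrand of the slope equation, as a function of the point `η`, the value `ρ` of `r` and
the mean `w` of `r` over `(0, η)`. -/
noncomputable def slopeSource (l m : ℕ) (h : ℝ → ℝ) (η ρ w : ℝ) : ℝ :=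
  steadySource l m ρ w + ((l:ℝ) + (m:ℝ) + 1) * h η * lengthCube l m ρ * η

variable {l m : ℕ} {Y M C : ℝ} {h r w : ℝ → ℝ}

lemma lengthCube_pos (l m : ℕ) (ρ : ℝ) : 0 < lengthCube l m ρ := by
  unfold lengthCube
  positivity

lemma measurable_lengthCube (l m : ℕ) : Measurable (lengthCube l m) := by
  unfold lengthCube
  fun_prop

lemma measurable_steadySource (l m : ℕ) :
    Measurable fun p : ℝ × ℝ => steadySource l m p.1 p.2 := by
  unfold steadySource
  fun_prop

lemma lengthCube_lipschitz (l m : ℕ) :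
    ∃ K ≥ (0:ℝ), ∃ δ > (0:ℝ), ∀ ρ₁ ρ₂ : ℝ, |ρ₁| < δ → |ρ₂| < δ →
      |lengthCube l m ρ₁ - lengthCube l m ρ₂| ≤ K * |ρ₁ - ρ₂| := by
  have hd : ContDiffAt ℝ 1 (lengthCube l m) 0 := by
    unfold lengthCube
    exact ContDiffAt.rpow_const_of_ne (by fun_prop) (by positivity)
  obtain ⟨K, t, ht, hK⟩ := hd.exists_lipschitzOnWith
  obtain ⟨δ, hδ, hball⟩ := Metric.mem_nhds_iff.1 ht
  refine ⟨K, K.2, δ, hδ, fun ρ₁ ρ₂ h₁ h₂ => ?_⟩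
  have := hK.dist_le_mul ρ₁ (hball (by simpa using h₁)) ρ₂ (hball (by simpa using h₂))
  simpa [Real.dist_eq] using this

lemma steadySource_hasStrictFDerivAt (hl : 1 ≤ l) (hm : 1 ≤ m) :
    HasStrictFDerivAt (fun p : ℝ × ℝ => steadySource l m p.1 p.2)
      (-((l:ℝ) + m) • ContinuousLinearMap.snd ℝ ℝ ℝ) 0 := by
  have hl0 : (0:ℝ) < l := by exact_mod_cast hl
  have hm0 : (0:ℝ) < m := by exact_mod_cast hm
  have hsl : 0 < Real.sqrt l := Real.sqrt_pos.2 hl0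
  have hsm : 0 < Real.sqrt m := Real.sqrt_pos.2 hm0
  have h₁ : HasStrictFDerivAt (fun p : ℝ × ℝ => p.1) (ContinuousLinearMap.fst ℝ ℝ ℝ) 0 :=
    hasStrictFDerivAt_fst
  have h₂ : HasStrictFDerivAt (fun p : ℝ × ℝ => p.2) (ContinuousLinearMap.snd ℝ ℝ ℝ) 0 :=
    hasStrictFDerivAt_snd
  have hquot : HasStrictDerivAt (fun w : ℝ => Real.sqrt m * w / (Real.sqrt m * w + Real.sqrt l))
      (Real.sqrt m / Real.sqrt l) 0 := by
    have hn : HasStrictDerivAt (fun w : ℝ => Real.sqrt m * w) (Real.sqrt m) 0 := by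
      simpa using (hasStrictDerivAt_id (0:ℝ)).const_mul (Real.sqrt m)
    have := hn.div (hn.add_const (Real.sqrt l)) (by simpa using hsl.ne')
    refine this.congr_deriv ?_
    simp only [mul_zero, zero_mul, zero_add, sub_zero]
    field_simp
  have hpoly : HasStrictDerivAt
      (fun ρ : ℝ => -(ρ ^ 2) * ((m:ℝ) * ρ + 2 * Real.sqrt ((l:ℝ) * (m:ℝ)))) 0 0 := by
    have hi := hasStrictDerivAt_id (0:ℝ)
    have := ((hi.pow 2).neg).mul ((hi.const_mul (m:ℝ)).add_const (2 * Real.sqrt ((l:ℝ) * (m:ℝ))))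
    exact this.congr_deriv (by simp)
  have hcoef : HasStrictDerivAt
      (fun ρ : ℝ => Real.sqrt ((l:ℝ) * (m:ℝ)) * (1 + (ρ + Real.sqrt ((l:ℝ) / (m:ℝ))) ^ 2))
      (Real.sqrt ((l:ℝ) * (m:ℝ)) * (2 * Real.sqrt ((l:ℝ) / (m:ℝ)))) 0 := by
    have hi := (hasStrictDerivAt_id (0:ℝ)).add_const (Real.sqrt ((l:ℝ) / (m:ℝ)))
    have := ((hi.pow 2).const_add 1).const_mul (Real.sqrt ((l:ℝ) * (m:ℝ)))
    simpa using this
  have hA := hpoly.comp_hasStrictFDerivAt (0 : ℝ × ℝ) h₁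
  have hB := hcoef.comp_hasStrictFDerivAt (0 : ℝ × ℝ) h₁
  have hC := hquot.comp_hasStrictFDerivAt (0 : ℝ × ℝ) h₂
  have hall := hA.sub (hB.mul hC)
  refine hall.congr_fderiv ?_
  have hval : Real.sqrt ((l:ℝ) * m) * (1 + Real.sqrt ((l:ℝ) / m) ^ 2)
      * (Real.sqrt m / Real.sqrt l) = (l:ℝ) + m := by
    rw [Real.sq_sqrt (by positivity), Real.sqrt_mul hl0.le]
    have := Real.sq_sqrt hm0.le
    field_simp
    nlinarith
  ext
  · simp
  · simp [← hval]

lemma steadySource_lipschitz (hl : 1 ≤ l) (hm : 1 ≤ m) {ε : ℝ} (hε : 0 < ε) :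
    ∃ δ > (0:ℝ), ∀ ρ₁ ρ₂ w₁ w₂ : ℝ, |ρ₁| < δ → |ρ₂| < δ → |w₁| < δ → |w₂| < δ →
      |steadySource l m ρ₁ w₁ - steadySource l m ρ₂ w₂|
        ≤ ((l:ℝ) + m) * |w₁ - w₂| + ε * max |ρ₁ - ρ₂| |w₁ - w₂| := by
  have h := (steadySource_hasStrictFDerivAt hl hm).isLittleO.def hε
  obtain ⟨δ, hδ, hball⟩ := Metric.eventually_nhds_iff.1 h
  refine ⟨δ, hδ, fun ρ₁ ρ₂ w₁ w₂ h₁ h₂ h₃ h₄ => ?_⟩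
  have h := @hball ((ρ₁, w₁), (ρ₂, w₂)) (by simp [Prod.dist_eq, h₁, h₂, h₃, h₄])
  simp only [Prod.mk_sub_mk, smul_apply, ContinuousLinearMap.coe_snd', smul_eq_mul,
    Prod.norm_mk, Real.norm_eq_abs] at h
  have h' := abs_add_le (steadySource l m ρ₁ w₁ - steadySource l m ρ₂ w₂
    - -((l:ℝ) + m) * (w₁ - w₂)) (-((l:ℝ) + m) * (w₁ - w₂))
  rw [sub_add_cancel, abs_mul (-((l:ℝ) + m)), abs_neg,
    abs_of_nonneg (by positivity : (0:ℝ) ≤ (l:ℝ) + m)] at h'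
  linarith

lemma slopeSource_aemeasurable (hh : AEMeasurable h (volume.restrict (Ioc 0 Y)))
    (hr : AEMeasurable r (volume.restrict (Ioc 0 Y)))
    (hw : AEMeasurable w (volume.restrict (Ioc 0 Y))) :
    AEMeasurable (fun η => slopeSource l m h η (r η) (w η)) (volume.restrict (Ioc 0 Y)) := by
  unfold slopeSource
  have h₁ := (measurable_steadySource l m).comp_aemeasurable (hr.prodMk hw)
  have h₂ := (measurable_lengthCube l m).comp_aemeasurable hr
  exact h₁.add (((hh.const_mul _).mul h₂).mul (by fun_prop))

/-- The mean curvature can be recovered from the integrand of the slope equation, so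
integrability of the latter forces measurability of the former. -/
lemma aemeasurable_of_slopeSource {j : ℕ} (hr : LinearlyBounded Y M r)
    (hi : AEMeasurable (fun η => slopeSource l m h η (r η) (weightedMean 1 r η) * η ^ j)
      (volume.restrict (Ioc 0 Y))) :
    AEMeasurable h (volume.restrict (Ioc 0 Y)) := by
  have h₁ := (measurable_steadySource l m).comp_aemeasurable
    (hr.aemeasurable.prodMk hr.mean.aemeasurable)
  have h₂ := (measurable_lengthCube l m).comp_aemeasurable hr.aemeasurable
  have hj : AEMeasurable (fun η : ℝ => η ^ j) (volume.restrict (Ioc 0 Y)) := by fun_prop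
  refine (((hi.div hj).sub h₁).div
    ((h₂.const_mul ((l:ℝ) + m + 1)).mul aemeasurable_id)).congr ?_
  refine (ae_restrict_iff' measurableSet_Ioc).2 (Eventually.of_forall fun η hη => ?_)
  have hη := hη.1.ne'
  have hB := (lengthCube_pos l m (r η)).ne'
  have hk : (l:ℝ) + m + 1 ≠ 0 := by positivity
  simp only [slopeSource, Pi.sub_apply, Pi.div_apply, Pi.mul_apply, Function.comp_apply, id]
  field_simp
  ring

lemma picard_slopeSource_eq_zero {k : ℕ} (hr : LinearlyBounded Y M r)
    (hh : ∀ y > 0, ¬ AEMeasurable h (volume.restrict (Ioc 0 y))) :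
    EqOn (picard k (slopeSource l m h) r) 0 (Ioc 0 Y) := by
  intro y hy
  rw [picard, weightedMean, intervalIntegral.integral_undef, mul_zero, Pi.zero_apply]
  intro hi
  rw [intervalIntegrable_iff_integrableOn_Ioc_of_le hy.1.le] at hi
  exact hh y hy.1 (aemeasurable_of_slopeSource (hr.mono hy.2) hi.aemeasurable)

lemma slopeSource_isLipschitzSource (hl : 1 ≤ l) (hm : 1 ≤ m) (hM : 0 < M) (hC : 0 ≤ C) :
    ∃ Z > (0:ℝ), ∀ (h : ℝ → ℝ) (Y : ℝ), Y ≤ Z → (∀ y ∈ Ioc (0:ℝ) Y, |h y| ≤ C) →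
      AEMeasurable h (volume.restrict (Ioc 0 Y)) →
      IsLipschitzSource Y M (((l:ℝ) + m + 1) * C * lengthCube l m 0) (((l:ℝ) + m + 1) / 2)
        (slopeSource l m h) := by
  obtain ⟨δ, hδ, hS⟩ := steadySource_lipschitz hl hm (ε := 1 / 4) (by norm_num)
  obtain ⟨K, hK, δ', hδ', hB⟩ := lengthCube_lipschitz l m
  set D := ((l:ℝ) + m + 1) * C * K with hD
  have hD0 : 0 ≤ D := by positivity
  refine ⟨min (min (δ / (2 * M)) (δ' / (2 * M))) (1 / (4 * (D + 1))), by positivity,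
    fun h Y hY hhC hh => ⟨fun r w hr hw => slopeSource_aemeasurable hh hr hw, ?_, ?_⟩⟩
  · intro η hη
    have : slopeSource l m h η 0 0 = ((l:ℝ) + m + 1) * h η * lengthCube l m 0 * η := by
      simp [slopeSource, steadySource]
    have hη0 := hη.1
    have hB0 := lengthCube_pos l m 0
    rw [this, abs_mul, abs_mul, abs_mul, abs_of_pos hη0, abs_of_pos hB0,
      abs_of_pos (by positivity : (0:ℝ) < (l:ℝ) + m + 1)]
    gcongr
    exact hhC η hη
  · intro η hη d ρ₁ ρ₂ w₁ w₂ hρ₁ hρ₂ hw₁ hw₂ hρ hw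
    have hη0 := hη.1
    have hηZ := hη.2.trans hY
    simp only [le_min_iff] at hηZ
    obtain ⟨⟨hZ₁, hZ₂⟩, hZ₃⟩ := hηZ
    rw [le_div_iff₀ (by positivity)] at hZ₁ hZ₂ hZ₃
    have hMη : 0 < M * η := by positivity
    have hs := hS ρ₁ ρ₂ w₁ w₂ (by linarith) (by linarith) (by linarith) (by linarith)
    have hb := hB ρ₁ ρ₂ (by linarith) (by linarith)
    have hdη : 0 ≤ d * η := (abs_nonneg _).trans hρ
    have hmax : max |ρ₁ - ρ₂| |w₁ - w₂| ≤ d * η := max_le hρ (by linarith)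
    have hlm : ((l:ℝ) + m) * |w₁ - w₂| ≤ ((l:ℝ) + m) * (d / 2 * η) := by gcongr
    have hcurv : |((l:ℝ) + m + 1) * h η * (lengthCube l m ρ₁ - lengthCube l m ρ₂) * η|
        ≤ 1 / 4 * (d * η) := by
      rw [abs_mul, abs_mul, abs_mul, abs_of_pos hη0,
        abs_of_pos (by positivity : (0:ℝ) < (l:ℝ) + m + 1)]
      calc ((l:ℝ) + m + 1) * |h η| * |lengthCube l m ρ₁ - lengthCube l m ρ₂| * η
          ≤ ((l:ℝ) + m + 1) * C * (K * (d * η)) * η := by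
            gcongr
            · exact hhC η hη
            · exact hb.trans (by gcongr)
        _ = (D * η) * (d * η) := by rw [hD]; ring
        _ ≤ 1 / 4 * (d * η) := by
            gcongr
            linarith
    have hsplit : slopeSource l m h η ρ₁ w₁ - slopeSource l m h η ρ₂ w₂
        = (steadySource l m ρ₁ w₁ - steadySource l m ρ₂ w₂)
          + ((l:ℝ) + m + 1) * h η * (lengthCube l m ρ₁ - lengthCube l m ρ₂) * η := by
      simp only [slopeSource]
      ring
    rw [hsplit]
    refine (abs_add_le _ _).trans ?_
    linarith

lemma picard_slopeSource (l m : ℕ) (h r : ℝ → ℝ) (y : ℝ) :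
    picard (l + m) (slopeSource l m h) r y = y ^ (-((l:ℤ) + (m:ℤ))) *
      ∫ η in (0:ℝ)..y,
        (-(r η ^ 2) * ((m:ℝ) * r η + 2 * Real.sqrt ((l:ℝ) * (m:ℝ)))
          - Real.sqrt ((l:ℝ) * (m:ℝ))
              * (1 + (r η + Real.sqrt ((l:ℝ) / (m:ℝ))) ^ 2)
              * ((Real.sqrt (m:ℝ) / η * ∫ ξ in (0:ℝ)..η, r ξ)
                  / (Real.sqrt (m:ℝ) / η * (∫ ξ in (0:ℝ)..η, r ξ)
                      + Real.sqrt (l:ℝ)))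
          + ((l:ℝ) + (m:ℝ) + 1) * h η
              * (1 + (r η + Real.sqrt ((l:ℝ) / (m:ℝ))) ^ 2) ^ ((3:ℝ)/2) * η)
        * η ^ (l + m - 1) := by
  simp only [picard, weightedMean_one, slopeSource, steadySource, lengthCube, div_mul_eq_mul_div,
    mul_div_assoc]
  simp only [weightedMean, Nat.cast_add]

end SlopeSource

/-- Existence and uniqueness for the integral equation satisfied by
`r = q - √(l/m)`, where `q` is the slope of the generating curve of an
`O(l+1)×O(m+1)`-type hypersurface (`n = l+m+2`) passing through the origin, in the class
`X_{Y,M} = {r ∈ C(0,Y] : sup |r(y)/y| ≤ M}`, for suitable `M` and `Y` with `MY < √(l/m)`. -/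
theorem stmt_17 (l m : ℕ) (hl : 1 ≤ l) (hm : 1 ≤ m) (Y : ℝ) (hY : 0 < Y)
    (Ht : ℝ → ℝ) (hHt : ∃ C : ℝ, ∀ y ∈ Set.Icc (0:ℝ) Y, |Ht y| ≤ C) :
    ∃ M₀ > (0:ℝ), ∀ M ≥ M₀, ∃ Y₂ > (0:ℝ), M * Y₂ < Real.sqrt ((l:ℝ) / (m:ℝ)) ∧
      ∀ Y₁, 0 < Y₁ → Y₁ ≤ Y₂ → Y₁ ≤ Y →
      ∃ r : ℝ → ℝ,
        (ContinuousOn r (Set.Ioc 0 Y₁) ∧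
          (∀ y ∈ Set.Ioc (0:ℝ) Y₁, |r y / y| ≤ M) ∧
          (∀ y ∈ Set.Ioc (0:ℝ) Y₁,
            r y = y ^ (-((l:ℤ) + (m:ℤ))) *
              ∫ η in (0:ℝ)..y,
                (-(r η ^ 2) * ((m:ℝ) * r η + 2 * Real.sqrt ((l:ℝ) * (m:ℝ)))
                  - Real.sqrt ((l:ℝ) * (m:ℝ))
                      * (1 + (r η + Real.sqrt ((l:ℝ) / (m:ℝ))) ^ 2)
                      * ((Real.sqrt (m:ℝ) / η * ∫ ξ in (0:ℝ)..η, r ξ)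
                          / (Real.sqrt (m:ℝ) / η * (∫ ξ in (0:ℝ)..η, r ξ)
                              + Real.sqrt (l:ℝ)))
                  + ((l:ℝ) + (m:ℝ) + 1) * Ht η
                      * (1 + (r η + Real.sqrt ((l:ℝ) / (m:ℝ))) ^ 2) ^ ((3:ℝ)/2) * η)
                * η ^ (l + m - 1))) ∧
        (∀ r' : ℝ → ℝ,
          (ContinuousOn r' (Set.Ioc 0 Y₁) ∧
            (∀ y ∈ Set.Ioc (0:ℝ) Y₁, |r' y / y| ≤ M) ∧
            (∀ y ∈ Set.Ioc (0:ℝ) Y₁,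
              r' y = y ^ (-((l:ℤ) + (m:ℤ))) *
                ∫ η in (0:ℝ)..y,
                  (-(r' η ^ 2) * ((m:ℝ) * r' η + 2 * Real.sqrt ((l:ℝ) * (m:ℝ)))
                    - Real.sqrt ((l:ℝ) * (m:ℝ))
                        * (1 + (r' η + Real.sqrt ((l:ℝ) / (m:ℝ))) ^ 2)
                        * ((Real.sqrt (m:ℝ) / η * ∫ ξ in (0:ℝ)..η, r' ξ)
                            / (Real.sqrt (m:ℝ) / η * (∫ ξ in (0:ℝ)..η, r' ξ)
                                + Real.sqrt (l:ℝ)))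
                    + ((l:ℝ) + (m:ℝ) + 1) * Ht η
                        * (1 + (r' η + Real.sqrt ((l:ℝ) / (m:ℝ))) ^ 2) ^ ((3:ℝ)/2) * η)
                  * η ^ (l + m - 1))) →
          Set.EqOn r r' (Set.Ioc 0 Y₁)) := by
  obtain ⟨C, hC⟩ := hHt
  have hC0 : 0 ≤ C := (abs_nonneg _).trans (hC 0 ⟨le_rfl, hY.le⟩)
  have hB0 := lengthCube_pos l m 0
  have ha : 0 < Real.sqrt ((l:ℝ) / (m:ℝ)) :=
    Real.sqrt_pos.2 (div_pos (by exact_mod_cast hl) (by exact_mod_cast hm))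
  refine ⟨2 * (C * lengthCube l m 0) + 1, by positivity, fun M hM => ?_⟩
  have hM0 : 0 < M := lt_of_lt_of_le (by positivity) hM
  suffices H : ∃ Y₂ > (0:ℝ), M * Y₂ < Real.sqrt ((l:ℝ) / (m:ℝ)) ∧
      ∀ Y₁, 0 < Y₁ → Y₁ ≤ Y₂ → Y₁ ≤ Y →
      ∃ r : ℝ → ℝ, (LinearlyBounded Y₁ M r ∧
          EqOn r (picard (l + m) (slopeSource l m Ht) r) (Ioc 0 Y₁)) ∧
        ∀ r' : ℝ → ℝ, LinearlyBounded Y₁ M r' ∧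
          EqOn r' (picard (l + m) (slopeSource l m Ht) r') (Ioc 0 Y₁) → EqOn r r' (Ioc 0 Y₁) by
    obtain ⟨Y₂, hY₂, hMY, H⟩ := H
    refine ⟨Y₂, hY₂, hMY, fun Y₁ h₁ h₂ h₃ => ?_⟩
    obtain ⟨r, ⟨hr, hfix⟩, huniq⟩ := H Y₁ h₁ h₂ h₃
    have hb := LinearlyBounded.iff_abs_div_le.1 hr
    exact ⟨r, ⟨hb.1, hb.2, fun y hy => (hfix hy).trans (picard_slopeSource l m Ht r y)⟩,
      fun r' hr' => huniq r' ⟨LinearlyBounded.iff_abs_div_le.2 ⟨hr'.1, hr'.2.1⟩,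
        fun y hy => (hr'.2.2 y hy).trans (picard_slopeSource l m Ht r' y).symm⟩⟩
  have hMlt : ∀ y ≤ Real.sqrt ((l:ℝ) / (m:ℝ)) / (2 * M), M * y < Real.sqrt ((l:ℝ) / (m:ℝ)) := by
    intro y hy
    rw [le_div_iff₀ (by positivity)] at hy
    linarith
  by_cases hmeas : ∃ y > (0:ℝ), AEMeasurable Ht (volume.restrict (Ioc 0 y))
  · obtain ⟨y₀, hy₀, hmeas⟩ := hmeas
    obtain ⟨Z, hZ, hsource⟩ := slopeSource_isLipschitzSource hl hm hM0 hC0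
    refine ⟨min (min Z y₀) (Real.sqrt ((l:ℝ) / (m:ℝ)) / (2 * M)), by positivity,
      hMlt _ (min_le_right _ _), fun Y₁ h₁ h₂ h₃ => ?_⟩
    simp only [le_min_iff] at h₂
    have hΦ := hsource Ht Y₁ h₂.1.1 (fun y hy => hC y ⟨hy.1.le, hy.2.trans h₃⟩)
      (hmeas.mono_measure (Measure.restrict_mono (Ioc_subset_Ioc_right h₂.1.2) le_rfl))
    have hk : 1 ≤ l + m := by omega
    have hL : 0 ≤ ((l:ℝ) + m + 1) / 2 := by positivity
    have hLk : ((l:ℝ) + m + 1) / 2 < ((l + m : ℕ) : ℝ) + 1 := by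
      push_cast
      linarith [(by positivity : (0:ℝ) < (l:ℝ) + m + 1)]
    have hc : ((l:ℝ) + m + 1) * C * lengthCube l m 0 + ((l:ℝ) + m + 1) / 2 * M
        ≤ (((l + m : ℕ) : ℝ) + 1) * M := by
      have := mul_le_mul_of_nonneg_left (show C * lengthCube l m 0 ≤ M / 2 by linarith)
        (by positivity : (0:ℝ) ≤ (l:ℝ) + m + 1)
      push_cast
      linarith
    obtain ⟨r, hr, hfix⟩ := hΦ.exists_fixed hk hM0.le hL hLk hc
    exact ⟨r, ⟨hr, hfix⟩, fun r' hr' =>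
      hΦ.eqOn_of_fixed hk hM0.le hL hLk hr hr'.1 hfix hr'.2⟩
  · push Not at hmeas
    refine ⟨Real.sqrt ((l:ℝ) / (m:ℝ)) / (2 * M), by positivity, hMlt _ le_rfl,
      fun Y₁ h₁ h₂ h₃ => ?_⟩
    have h0 : LinearlyBounded Y₁ M 0 :=
      ⟨continuousOn_const, fun y hy => by simpa using (mul_pos hM0 hy.1).le⟩
    exact ⟨0, ⟨h0, (picard_slopeSource_eq_zero h0 hmeas).symm⟩, fun r' hr' =>
      (hr'.2.trans (picard_slopeSource_eq_zero hr'.1 hmeas)).symm⟩
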